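/- Let (Ω, 𝔉, μ) be a probability space, Δ ≥ 1 an integer, N ≥ 0 a real constant, and let h and I be independent real random variables with I ≥ 0 almost surely and h Gamma-distributed with shape Δ and rate 1. Define F(s) = e^{−sN} · E[e^{−sI}] for s > 0. Then F is infinitely differentiable on (0, ∞) and for every s > 0, P(h > s(I + N)) = ∑_{k=0}^{Δ−1} ((−s)^k / k!) · F^{(k)}(s). -/

import Mathlib

open MeasureTheory ProbabilityTheory

/-- Survival function of the Erlang distribution. -/
noncomputable def erlangTail (n : ℕ) (x : ℝ) : ℝ :=
  ∑ k ∈ Finset.range n, x ^ k / (Nat.factorial k : ℝ) * Real.exp (-x)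

lemma erlangTail_hasDerivAt (n : ℕ) (x : ℝ) :
    HasDerivAt (erlangTail (n + 1)) (-(x ^ n / (Nat.factorial n : ℝ) * Real.exp (-x))) x := by
  have he : HasDerivAt (fun y : ℝ => Real.exp (-y)) (-Real.exp (-x)) x := by
    simpa using (hasDerivAt_neg x).exp
  induction n with
  | zero =>
    have : erlangTail (0 + 1) = fun y => Real.exp (-y) := by
      funext y; simp [erlangTail]
    rw [this]
    simpa using he
  | succ n ih =>
    have h1 : erlangTail (n + 1 + 1) = fun y => erlangTail (n + 1) y +
        y ^ (n + 1) / (Nat.factorial (n + 1) : ℝ) * Real.exp (-y) := by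
      funext y; simp only [erlangTail]; rw [Finset.sum_range_succ _ (n + 1)]
    rw [h1]
    have h2 := ih.add (((hasDerivAt_pow (n + 1) x).div_const (Nat.factorial (n + 1) : ℝ)).mul he)
    refine h2.congr_deriv ?_
    have : (Nat.factorial n : ℝ) ≠ 0 := by positivity
    have : (n : ℝ) + 1 ≠ 0 := by positivity
    simp only [Nat.factorial_succ, Nat.cast_mul, Nat.cast_add, Nat.cast_one, Nat.add_sub_cancel]
    field_simp
    ring

lemma erlangTail_tendsto (n : ℕ) :
    Filter.Tendsto (erlangTail n) Filter.atTop (nhds 0) := by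
  have : Filter.Tendsto (fun x : ℝ => ∑ k ∈ Finset.range n,
      x ^ k / (Nat.factorial k : ℝ) * Real.exp (-x)) Filter.atTop
      (nhds (∑ k ∈ Finset.range n, (0 : ℝ))) := by
    refine tendsto_finsetSum _ fun k _ => ?_
    have h := (Real.tendsto_pow_mul_exp_neg_atTop_nhds_zero k).div_const (Nat.factorial k : ℝ)
    simp only [zero_div] at h
    refine h.congr fun x => ?_
    ring
  rw [Finset.sum_const_zero] at this
  exact this

lemma gamma_tail (n : ℕ) (x : ℝ) (hx : 0 ≤ x) :
    gammaMeasure ((n + 1 : ℕ) : ℝ) 1 (Set.Ioi x) = ENNReal.ofReal (erlangTail (n + 1) x) := by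
  have hneg : ∀ y ∈ Set.Ioi x, -(y ^ n / (Nat.factorial n : ℝ) * Real.exp (-y)) ≤ 0 := by
    intro y hy
    have : 0 ≤ y := hx.trans (le_of_lt hy)
    have : 0 ≤ y ^ n / (Nat.factorial n : ℝ) * Real.exp (-y) := by positivity
    linarith
  have hint := integrableOn_Ioi_deriv_of_nonpos' (fun y _ => erlangTail_hasDerivAt n y) hneg
    (erlangTail_tendsto (n + 1))
  have hval := integral_Ioi_of_hasDerivAt_of_nonpos' (fun y _ => erlangTail_hasDerivAt n y) hneg
    (erlangTail_tendsto (n + 1))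
  have hval' : ∫ y in Set.Ioi x, (y ^ n / (Nat.factorial n : ℝ) * Real.exp (-y))
      = erlangTail (n + 1) x := by
    rw [integral_neg] at hval
    linarith
  have hint' : IntegrableOn (fun y : ℝ => y ^ n / (Nat.factorial n : ℝ) * Real.exp (-y))
      (Set.Ioi x) := by
    simpa using hint.neg
  rw [gammaMeasure, withDensity_apply _ measurableSet_Ioi, ← hval',
    ofReal_integral_eq_lintegral_ofReal hint']
  · refine setLIntegral_congr_fun measurableSet_Ioi fun y hy => ?_
    have hy0 : 0 ≤ y := hx.trans (le_of_lt hy)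
    simp only [gammaPDF_of_nonneg hy0]
    congr 1
    have h1 : Real.Gamma ((n + 1 : ℕ) : ℝ) = (Nat.factorial n : ℝ) := by
      rw [Nat.cast_add, Nat.cast_one, Real.Gamma_nat_eq_factorial]
    have h2 : ((n + 1 : ℕ) : ℝ) - 1 = (n : ℝ) := by push_cast; ring
    rw [h1, h2, Real.one_rpow, Real.rpow_natCast]
    ring_nf
  · refine (ae_restrict_iff' measurableSet_Ioi).mpr (ae_of_all _ fun y hy => ?_)
    have := hneg y hy
    simp only [Pi.zero_apply]
    linarith

/-- Integrand identity of Theorem 1 (coverage probability of the noncooperative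
MU-MIMO HetNet): with `F(s) = e^{−sN}·E[e^{−sI}]`, `F` is infinitely differentiable on
`(0,∞)` and `P(h > s(I + N)) = ∑_{k=0}^{Δ−1} ((−s)^k/k!) F^(k)(s)` for every `s > 0`. -/
theorem stmt_7 {Ω : Type*} [MeasurableSpace Ω] (μ : Measure Ω) [IsProbabilityMeasure μ]
    (Δ : ℕ) (hΔ : 1 ≤ Δ) (N : ℝ) (hN : 0 ≤ N) (h I : Ω → ℝ)
    (hh : Measurable h) (hI : Measurable I) (hInn : ∀ᵐ ω ∂μ, 0 ≤ I ω)
    (hindep : IndepFun h I μ)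
    (hgamma : Measure.map h μ = gammaMeasure (Δ : ℝ) 1) :
    ContDiffOn ℝ (⊤ : ℕ∞)
      (fun s : ℝ => Real.exp (-(s * N)) * ∫ ω, Real.exp (-(s * I ω)) ∂μ) (Set.Ioi 0) ∧
    ∀ s : ℝ, 0 < s →
      (μ {ω | h ω > s * (I ω + N)}).toReal
        = ∑ k ∈ Finset.range Δ, ((-s) ^ k / (Nat.factorial k : ℝ)) *
            iteratedDeriv k
              (fun s : ℝ => Real.exp (-(s * N)) * ∫ ω, Real.exp (-(s * I ω)) ∂μ) s := by
  set X : Ω → ℝ := fun ω => -(I ω + N) with hX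
  have hXm : Measurable X := (hI.add_const N).neg
  have hF : (fun s : ℝ => Real.exp (-(s * N)) * ∫ ω, Real.exp (-(s * I ω)) ∂μ) = mgf X μ := by
    funext s
    rw [mgf, ← integral_const_mul]
    refine integral_congr_ae (ae_of_all _ fun ω => ?_)
    simp only [hX, ← Real.exp_add]
    congr 1
    ring
  rw [hF]
  have hsub : Set.Ioi (0 : ℝ) ⊆ interior (integrableExpSet X μ) := by
    refine interior_maximal (fun s hs => ?_) isOpen_Ioi
    have hs0 : (0 : ℝ) < s := hs
    refine Integrable.of_bound (C := 1) (hXm.const_mul s).exp.aestronglyMeasurable ?_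
    filter_upwards [hInn] with ω hω
    rw [Real.norm_eq_abs, Real.abs_exp, Real.exp_le_one_iff]
    have : 0 ≤ s * (I ω + N) := by positivity
    simp only [hX]
    linarith
  refine ⟨((analyticOnNhd_mgf (X := X) (μ := μ)).mono hsub).contDiffOn (uniqueDiffOn_Ioi 0), ?_⟩
  intro s hs
  obtain ⟨n, rfl⟩ : ∃ n, Δ = n + 1 := ⟨Δ - 1, by omega⟩
  have hs' := hsub hs
  have hintk : ∀ k : ℕ, Integrable (fun ω => X ω ^ k * Real.exp (s * X ω)) μ := fun k =>
    integrable_pow_mul_exp_of_mem_interior_integrableExpSet hs' k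
  have hterm : ∀ k ω, ((-s) ^ k / (Nat.factorial k : ℝ)) * (X ω ^ k * Real.exp (s * X ω))
      = (s * (I ω + N)) ^ k / (Nat.factorial k : ℝ) * Real.exp (-(s * (I ω + N))) := by
    intro k ω
    have h1 : s * (I ω + N) = (-s) * X ω := by simp only [hX]; ring
    rw [h1, mul_pow]
    ring_nf
  have hrhs : ∑ k ∈ Finset.range (n + 1), ((-s) ^ k / (Nat.factorial k : ℝ)) *
      iteratedDeriv k (mgf X μ) s = ∫ ω, erlangTail (n + 1) (s * (I ω + N)) ∂μ := by
    simp only [erlangTail, ← hterm]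
    rw [integral_finsetSum _ fun k _ => (hintk k).const_mul _]
    refine Finset.sum_congr rfl fun k _ => ?_
    rw [integral_const_mul, iteratedDeriv_mgf hs']
  have hgint : Integrable (fun ω => erlangTail (n + 1) (s * (I ω + N))) μ := by
    simp only [erlangTail, ← hterm]
    exact integrable_finsetSum _ fun k _ => (hintk k).const_mul _
  have hnn : ∀ᵐ ω ∂μ, 0 ≤ erlangTail (n + 1) (s * (I ω + N)) := by
    filter_upwards [hInn] with ω hω
    simp only [erlangTail]
    positivity
  rw [hrhs, integral_eq_lintegral_of_nonneg_ae hnn hgint.aestronglyMeasurable]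
  congr 1
  have hmap := (indepFun_iff_map_prod_eq_prod_map_map hh.aemeasurable hI.aemeasurable).mp hindep
  have hS : MeasurableSet {p : ℝ × ℝ | p.1 > s * (p.2 + N)} :=
    measurableSet_lt (by fun_prop) (by fun_prop)
  have : IsProbabilityMeasure (μ.map h) := Measure.isProbabilityMeasure_map hh.aemeasurable
  have : IsProbabilityMeasure (μ.map I) := Measure.isProbabilityMeasure_map hI.aemeasurable
  have h1 : μ {ω | h ω > s * (I ω + N)}
      = μ.map (fun ω => (h ω, I ω)) {p : ℝ × ℝ | p.1 > s * (p.2 + N)} := by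
    rw [Measure.map_apply (hh.prodMk hI) hS]; rfl
  rw [h1, hmap, Measure.prod_apply_symm hS,
    lintegral_map (measurable_measure_prodMk_right hS) hI]
  refine lintegral_congr_ae ?_
  filter_upwards [hInn] with ω hω
  rw [hgamma, ← gamma_tail n _ (by positivity)]
  rfl
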